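/- arXiv:2301.09818 — 3 statements merged into one kernel-verified Lean document; each statement's English description precedes it below -/
import Mathlib

section
/- Assume the eigengap assumption λ₁ > λ₀ for the linearized problem at the ground state u*. Then for every u ∈ M with ‖u − u*‖²_{L²(Ω)} ≤ 2, it holds that E(u) − E(u*) ≥ ((λ₁ − λ₀)/4)·‖u − u*‖²_{L²(Ω)}. -/
open scoped RealInnerProductSpace
open Filter Topology

/-- Abstract setting for the Gross–Pitaevskii eigenvalue problem on a bounded
Lipschitz domain `Ω ⊆ ℝᵈ` (`d ∈ {1,2,3}`) with potential `0 ≤ V ≤ Vmax` in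
`L^∞(Ω)` and interaction parameter `β ≥ 0`.

The Hilbert space `H` plays the role of `H¹₀(Ω)` equipped with the inner product
`(z,w)_{H¹₀} = (∇z,∇w)_{L²}`; `P z w` is the `L²(Ω)` inner product `∫ z w`,
`Vf z w = ∫ V z w`, and `Q4 a b c d = ∫ a b c d` (defined on `H` thanks to the
Sobolev embedding `H¹₀ ↪ L⁴` valid for `d ≤ 3`).

`C₁`, `C₂`, `C₃` are, respectively, the constants of the embedding
`‖u‖_{L⁴} ≤ C₁ ‖u‖_{H¹₀}`, of the embedding `‖·‖_{H⁻¹} ≤ C₂ ‖·‖_{L^{4/3}}`,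
and of the Poincaré inequality `‖u‖_{L²} ≤ C₃ ‖u‖_{H¹₀}`.

`G`, `GV`, `Gc` are, respectively, `G_{H¹}`, `u ↦ G_{H¹}(V u)` and
`u ↦ G_{H¹}(|u|² u)`, characterized by their defining Riesz identities
(`Gc_bound` encodes `‖G_{H¹}(|u|²u)‖_{H¹₀} ≤ ‖u³‖_{H⁻¹} ≤ C₂ ‖u³‖_{L^{4/3}}
= C₂ ‖u‖_{L⁴}³`).  `G0`, `G0c` are the analogous Green operators for the
`a₀`-inner product `(z,w)_{a₀} = ∫ ∇z·∇w + V z w`, and `Gau u` is the Green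
operator for the `a_u`-inner product
`(z,w)_{a_u} = ∫ ∇z·∇w + V z w + β|u|² z w`. -/
structure GPSetting (H : Type*) [NormedAddCommGroup H] [InnerProductSpace ℝ H] where
  /-- the `L²(Ω)` inner product `(z,w)_{L²} = ∫ z w` on `H = H¹₀(Ω)` -/
  P : H →ₗ[ℝ] H →ₗ[ℝ] ℝ
  P_symm : ∀ z w : H, P z w = P w z
  P_nonneg : ∀ z : H, 0 ≤ P z z
  P_definite : ∀ z : H, P z z = 0 → z = 0
  /-- `Vmax`, the (essential) upper bound of the potential `V` -/
  Vmax : ℝ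
  Vmax_nonneg : 0 ≤ Vmax
  /-- the bilinear form `Vf z w = ∫ V z w` -/
  Vf : H →ₗ[ℝ] H →ₗ[ℝ] ℝ
  Vf_symm : ∀ z w : H, Vf z w = Vf w z
  Vf_nonneg : ∀ z : H, 0 ≤ Vf z z
  Vf_le : ∀ z : H, Vf z z ≤ Vmax * P z z
  /-- the interaction parameter `β ≥ 0` -/
  β : ℝ
  β_nonneg : 0 ≤ β
  /-- the quadrilinear form `Q4 a b c d = ∫ a b c d` -/
  Q4 : H →ₗ[ℝ] H →ₗ[ℝ] H →ₗ[ℝ] H →ₗ[ℝ] ℝ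
  Q4_symm₁ : ∀ a b c d : H, Q4 a b c d = Q4 b a c d
  Q4_symm₂ : ∀ a b c d : H, Q4 a b c d = Q4 a c b d
  Q4_symm₃ : ∀ a b c d : H, Q4 a b c d = Q4 a b d c
  Q4_sq_nonneg : ∀ z w : H, 0 ≤ Q4 z z w w
  /-- the constant of the Sobolev embedding `‖u‖_{L⁴} ≤ C₁ ‖u‖_{H¹₀}` -/
  C₁ : ℝ
  C₁_pos : 0 < C₁
  embed_L4 : ∀ u : H, Q4 u u u u ≤ C₁ ^ 4 * ‖u‖ ^ 4
  /-- the constant of the embedding `‖·‖_{H⁻¹} ≤ C₂ ‖·‖_{L^{4/3}}` -/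
  C₂ : ℝ
  C₂_pos : 0 < C₂
  /-- the Poincaré constant: `‖u‖_{L²} ≤ C₃ ‖u‖_{H¹₀}` -/
  C₃ : ℝ
  C₃_pos : 0 < C₃
  poincare : ∀ u : H, P u u ≤ C₃ ^ 2 * ‖u‖ ^ 2
  /-- the Green operator `G_{H¹}`: `(z, G_{H¹} w)_{H¹₀} = (z,w)_{L²}` -/
  G : H →ₗ[ℝ] H
  G_def : ∀ z w : H, ⟪z, G w⟫ = P z w
  /-- `GV w = G_{H¹}(V w)`: `(z, G_{H¹}(Vw))_{H¹₀} = ∫ V z w` -/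
  GV : H →ₗ[ℝ] H
  GV_def : ∀ z w : H, ⟪z, GV w⟫ = Vf z w
  /-- `Gc w = G_{H¹}(|w|² w)`: `(z, G_{H¹}(w³))_{H¹₀} = ∫ z w³` -/
  Gc : H → H
  Gc_def : ∀ z w : H, ⟪z, Gc w⟫ = Q4 z w w w
  Gc_bound : ∀ w : H, ‖Gc w‖ ≤ C₂ * (Q4 w w w w) ^ ((3 : ℝ) / 4)
  /-- the Green operator `G_{a₀}`: `(z, G_{a₀} w)_{a₀} = (z,w)_{L²}` -/
  G0 : H →ₗ[ℝ] H
  G0_def : ∀ z w : H, ⟪z, G0 w⟫ + Vf z (G0 w) = P z w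
  /-- `G0c w = G_{a₀}(|w|² w)` -/
  G0c : H → H
  G0c_def : ∀ z w : H, ⟪z, G0c w⟫ + Vf z (G0c w) = Q4 z w w w
  /-- the Green operator `G_{a_u}`: `(z, G_{a_u} w)_{a_u} = (z,w)_{L²}` -/
  Gau : H → H → H
  Gau_def : ∀ u z w : H,
    ⟪z, Gau u w⟫ + Vf z (Gau u w) + β * Q4 u u z (Gau u w) = P z w

namespace GPSetting

variable {H : Type*} [NormedAddCommGroup H] [InnerProductSpace ℝ H] (S : GPSetting H)

/-- the `L²(Ω)` norm -/
noncomputable def l2norm (u : H) : ℝ := Real.sqrt (S.P u u)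

/-- the `L⁴(Ω)` norm -/
noncomputable def l4norm (u : H) : ℝ := (S.Q4 u u u u) ^ ((1 : ℝ) / 4)

/-- the `H⁻¹(Ω)` (dual) norm of an element of `H¹₀(Ω)` -/
noncomputable def HnegNorm (u : H) : ℝ := ⨆ z : {z : H // ‖z‖ ≤ 1}, S.P z.1 u

/-- the manifold `M = {u ∈ H¹₀(Ω) : ‖u‖_{L²} = 1}` -/
def Msphere : Set H := {u : H | S.P u u = 1}

/-- the Gross–Pitaevskii energy
`E(u) = ∫ (1/2)|∇u|² + (1/2)V|u|² + (β/4)|u|⁴` -/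
noncomputable def energy (u : H) : ℝ :=
  (1 / 2) * ‖u‖ ^ 2 + (1 / 2) * S.Vf u u + (S.β / 4) * S.Q4 u u u u

/-- the retraction `R(u) = u / ‖u‖_{L²}` -/
noncomputable def retract (u : H) : H := (S.l2norm u)⁻¹ • u

/-- the `H¹`-gradient `∇_{H¹}E(u) = u + G_{H¹}(Vu + β|u|²u)` -/
noncomputable def gradH1 (u : H) : H := u + S.GV u + S.β • S.Gc u

/-- the Riemannian `H¹`-gradient
`∇^R_{H¹}E(u) = ∇_{H¹}E(u) − ((∇_{H¹}E(u),u)_{L²}/‖G_{H¹}u‖²_{H¹₀}) G_{H¹}u` -/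
noncomputable def gradRH1 (u : H) : H :=
  S.gradH1 u - (S.P (S.gradH1 u) u / ‖S.G u‖ ^ 2) • S.G u

/-- the `a₀`-inner product `(z,w)_{a₀} = ∫ ∇z·∇w + Vzw` -/
noncomputable def a0inner (z w : H) : ℝ := ⟪z, w⟫ + S.Vf z w

/-- the `a₀`-norm -/
noncomputable def a0norm (z : H) : ℝ := Real.sqrt (S.a0inner z z)

/-- the `a₀`-gradient `∇_{a₀}E(u) = u + β G_{a₀}(|u|²u)` -/
noncomputable def gradA0 (u : H) : H := u + S.β • S.G0c u

/-- the Riemannian `a₀`-gradient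
`∇^R_{a₀}E(u) = ∇_{a₀}E(u) − ((∇_{a₀}E(u),u)_{L²}/‖G_{a₀}u‖²_{a₀}) G_{a₀}u` -/
noncomputable def gradRA0 (u : H) : H :=
  S.gradA0 u - (S.P (S.gradA0 u) u / (S.a0norm (S.G0 u)) ^ 2) • S.G0 u

/-- the `a_u`-inner product `(z,w)_{a_u} = ∫ ∇z·∇w + Vzw + β|u|²zw` -/
noncomputable def auinner (u z w : H) : ℝ :=
  ⟪z, w⟫ + S.Vf z w + S.β * S.Q4 u u z w

/-- the `a_u`-norm -/
noncomputable def aunorm (u z : H) : ℝ := Real.sqrt (S.auinner u z z)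

/-- the Riemannian `a_u`-gradient
`∇^R_{a_u}E(u) = u − G_{a_u}u / ‖G_{a_u}u‖²_{a_u}` -/
noncomputable def gradRAu (u : H) : H :=
  u - ((S.aunorm u (S.Gau u u)) ^ 2)⁻¹ • S.Gau u u

/-- `ustar` is the ground state: the minimizer of `E` over `M`. -/
def IsGroundState (ustar : H) : Prop :=
  ustar ∈ S.Msphere ∧ ∀ u ∈ S.Msphere, S.energy ustar ≤ S.energy u

/-- `lam0` and `lam1` are the smallest and second smallest eigenvalues of the
linearized problem `(−Δ + V + β|u*|²)u = λu` at the ground state `u*` (whose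
bilinear form is the `a_{u*}`-inner product): `u*` is an eigenfunction for
`lam0`, `lam0` is a lower bound for the Rayleigh quotient, and `lam1` is a lower
bound for the Rayleigh quotient on the `L²`-orthogonal complement of `u*`. -/
def LinearizedEigs (ustar : H) (lam0 lam1 : ℝ) : Prop :=
  (∀ z : H, S.auinner ustar z ustar = lam0 * S.P z ustar) ∧
  (∀ z : H, lam0 * S.P z z ≤ S.auinner ustar z z) ∧
  (∀ z : H, S.P z ustar = 0 → lam1 * S.P z z ≤ S.auinner ustar z z)

end GPSetting

namespace GPSetting

variable {H : Type*} [NormedAddCommGroup H] [InnerProductSpace ℝ H] (S : GPSetting H)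

/-- The identity `∫ (u - v)² (u + v)² = ∫ (u² - v²)²`. -/
theorem Q4_sub_add (u v : H) :
    S.Q4 (u - v) (u - v) (u + v) (u + v) =
      S.Q4 u u u u - 2 * S.Q4 v v u u + S.Q4 v v v v := by
  rw [show u - v = u + (-1 : ℝ) • v by module]
  simp only [map_add, map_smul, LinearMap.add_apply, LinearMap.smul_apply, smul_eq_mul]
  have h1 : S.Q4 u v u v = S.Q4 v v u u := by
    rw [S.Q4_symm₁ u v, S.Q4_symm₃ v u, S.Q4_symm₂ v u]
  have h2 : S.Q4 u v v u = S.Q4 v v u u := by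
    rw [S.Q4_symm₁ u v, S.Q4_symm₂ v u]
  have h3 : S.Q4 v u u v = S.Q4 v v u u := by
    rw [S.Q4_symm₃ v u, S.Q4_symm₂ v u]
  have h4 : S.Q4 v u v u = S.Q4 v v u u := S.Q4_symm₂ v u v u
  have h5 : S.Q4 u u v v = S.Q4 v v u u := by
    rw [S.Q4_symm₂ u u, h1]
  have h6 : S.Q4 u v u u = S.Q4 u u u v := by
    rw [S.Q4_symm₂ u v, S.Q4_symm₃ u u v]
  have h7 : S.Q4 v u u u = S.Q4 u u u v := by rw [S.Q4_symm₁ v u, h6]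
  have h8 : S.Q4 u u v u = S.Q4 u u u v := S.Q4_symm₃ u u v u
  have h9 : S.Q4 u v v v = S.Q4 v v v u := by
    rw [S.Q4_symm₁ u v, S.Q4_symm₂ v u, S.Q4_symm₃ v v u]
  have h10 : S.Q4 v u v v = S.Q4 v v v u := by
    rw [S.Q4_symm₂ v u, S.Q4_symm₃ v v u]
  have h11 : S.Q4 v v u v = S.Q4 v v v u := S.Q4_symm₃ v v u v
  linarith

/-- The energy gap dominates half the gap of the quadratic forms `a_v`. -/
theorem half_auinner_sub_le_energy_sub (u v : H) :
    (S.auinner v u u - S.auinner v v v) / 2 ≤ S.energy u - S.energy v := by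
  have h := mul_nonneg S.β_nonneg (S.Q4_sq_nonneg (u - v) (u + v))
  rw [Q4_sub_add] at h
  simp only [auinner, energy, real_inner_self_eq_norm_sq]
  linarith

theorem auinner_symm (v z w : H) : S.auinner v z w = S.auinner v w z := by
  simp only [auinner]
  rw [real_inner_comm, S.Vf_symm z w, S.Q4_symm₃ v v z w]

theorem auinner_sub_smul_self (v u : H) (c : ℝ) :
    S.auinner v (u - c • v) (u - c • v) =
      S.auinner v u u - 2 * c * S.auinner v u v + c ^ 2 * S.auinner v v v := by
  have h := S.auinner_symm v v u
  simp only [auinner] at h ⊢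
  simp only [map_sub, map_smul, LinearMap.sub_apply, LinearMap.smul_apply, smul_eq_mul,
    inner_sub_left, inner_sub_right, real_inner_smul_left, real_inner_smul_right]
  linear_combination (-c) * h

theorem P_sub_smul_self (v u : H) (c : ℝ) :
    S.P (u - c • v) (u - c • v) = S.P u u - 2 * c * S.P u v + c ^ 2 * S.P v v := by
  simp only [map_sub, map_smul, LinearMap.sub_apply, LinearMap.smul_apply, smul_eq_mul,
    S.P_symm v u]
  ring

/-- The eigengap bounds the gap of the quadratic form `a_{u*}` on the unit sphere. -/
theorem LinearizedEigs.gap_mul_le {S : GPSetting H} {v u : H} {lam0 lam1 : ℝ}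
    (heig : S.LinearizedEigs v lam0 lam1) (hv : S.P v v = 1) (hu : S.P u u = 1) :
    (lam1 - lam0) * (1 - S.P u v ^ 2) ≤ S.auinner v u u - S.auinner v v v := by
  have horth : S.P (u - S.P u v • v) v = 0 := by simp [hv]
  have h := heig.2.2 _ horth
  rw [P_sub_smul_self, auinner_sub_smul_self, heig.1 u, heig.1 v, hu, hv] at h
  rw [heig.1 v, hv]
  linarith

end GPSetting

/-- **Local convexity of the energy at the ground state**
(Lemma `lem:Elocalconvex`).  Under the eigengap assumption `λ₁ > λ₀` for the
linearized problem at the ground state `u*`, every `u ∈ M` with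
`‖u − u*‖²_{L²} ≤ 2` satisfies
`E(u) − E(u*) ≥ ((λ₁ − λ₀)/4)‖u − u*‖²_{L²}`. -/
theorem energy_local_convexity
    {H : Type*} [NormedAddCommGroup H] [InnerProductSpace ℝ H]
    (S : GPSetting H) (ustar : H) (lam0 lam1 : ℝ)
    (hgs : S.IsGroundState ustar)
    (heig : S.LinearizedEigs ustar lam0 lam1)
    (hgap : lam0 < lam1) :
    ∀ u ∈ S.Msphere, (S.l2norm (u - ustar)) ^ 2 ≤ 2 →
      (lam1 - lam0) / 4 * (S.l2norm (u - ustar)) ^ 2 ≤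
        S.energy u - S.energy ustar := by
  intro u hu hle
  have hv : S.P ustar ustar = 1 := hgs.1
  have hu : S.P u u = 1 := hu
  have hnorm : S.l2norm (u - ustar) ^ 2 = 2 - 2 * S.P u ustar := by
    have h := S.P_sub_smul_self ustar u 1
    rw [one_smul] at h
    rw [GPSetting.l2norm, Real.sq_sqrt (S.P_nonneg _), h, hu, hv]
    ring
  have hpos : 0 ≤ S.l2norm (u - ustar) ^ 2 := sq_nonneg _
  rw [hnorm] at hle hpos ⊢
  have hE := S.half_auinner_sub_le_energy_sub u ustar
  have hA := heig.gap_mul_le hv hu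
  have hc : 0 ≤ (lam1 - lam0) * (S.P u ustar * (1 - S.P u ustar)) :=
    mul_nonneg (by linarith) (mul_nonneg (by linarith) (by linarith))
  linarith
end

section
/- Let C_u be the constant from the energy-decay theorem for the H¹-scheme. There exists a constant L_g, depending only on Ω, d, β, V, u*, and ‖u₀‖_{H^1_0(Ω)}, such that ‖∇^R_{H¹}E(u)‖_{H^1_0(Ω)} ≤ L_g·‖u − u*‖_{H^1_0(Ω)} holds for every u ∈ M with ‖u‖_{H^1_0(Ω)} ≤ C_u and ‖u − u*‖_{H^1_0(Ω)} sufficiently small. -/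
open scoped RealInnerProductSpace
open Filter Topology

namespace GPSetting

variable {H : Type*} [NormedAddCommGroup H] [InnerProductSpace ℝ H] (S : GPSetting H)

/-- A positive semidefinite symmetric form whose quadratic form is bounded by `K ‖·‖²` is bounded
by `K`. -/
theorem abs_form_le_of_diag_le (B : H →ₗ[ℝ] H →ₗ[ℝ] ℝ) (hsymm : ∀ z w, B z w = B w z)
    (hnonneg : ∀ z, 0 ≤ B z z) {K : ℝ} (hK : 0 ≤ K) (hB : ∀ z, B z z ≤ K * ‖z‖ ^ 2) (z w : H) :
    |B z w| ≤ K * ‖z‖ * ‖w‖ := by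
  refine abs_le_of_sq_le_sq ?_ (by positivity)
  calc B z w ^ 2 ≤ B z z * B w w :=
        LinearMap.BilinForm.apply_sq_le_of_symm B hnonneg ⟨hsymm⟩ z w
    _ ≤ (K * ‖z‖ ^ 2) * (K * ‖w‖ ^ 2) :=
        mul_le_mul (hB z) (hB w) (hnonneg w) (by positivity)
    _ = (K * ‖z‖ * ‖w‖) ^ 2 := by ring

theorem norm_le_of_abs_inner_le {x : H} {C : ℝ} (hC : 0 ≤ C) (h : ∀ z : H, |⟪z, x⟫| ≤ C * ‖z‖) :
    ‖x‖ ≤ C := by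
  rcases eq_or_ne x 0 with rfl | hx
  · simpa using hC
  · have hpos := norm_pos_iff.mpr hx
    have := (le_abs_self _).trans (h x)
    rw [real_inner_self_eq_norm_sq] at this
    nlinarith

theorem abs_P_le (z w : H) : |S.P z w| ≤ S.C₃ ^ 2 * ‖z‖ * ‖w‖ :=
  abs_form_le_of_diag_le S.P S.P_symm S.P_nonneg (by positivity) S.poincare z w

theorem abs_Vf_le (z w : H) : |S.Vf z w| ≤ S.Vmax * S.C₃ ^ 2 * ‖z‖ * ‖w‖ := by
  have hV := S.Vmax_nonneg
  refine abs_form_le_of_diag_le S.Vf S.Vf_symm S.Vf_nonneg (by positivity) (fun z => ?_) z w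
  calc S.Vf z z ≤ S.Vmax * S.P z z := S.Vf_le z
    _ ≤ S.Vmax * (S.C₃ ^ 2 * ‖z‖ ^ 2) := by gcongr; exact S.poincare z
    _ = _ := by ring

theorem Q4_add_smul_self (u z : H) (t : ℝ) :
    S.Q4 (u + t • z) (u + t • z) (u + t • z) (u + t • z) =
      S.Q4 u u u u + 4 * t * S.Q4 z u u u + 6 * t ^ 2 * S.Q4 u u z z
        + 4 * t ^ 3 * S.Q4 u z z z + t ^ 4 * S.Q4 z z z z := by
  have h₁ := S.Q4_symm₁
  have h₂ := S.Q4_symm₂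
  have h₃ := S.Q4_symm₃
  simp only [map_add, map_smul, LinearMap.add_apply, LinearMap.smul_apply, smul_eq_mul]
  have e1 : S.Q4 u u u z = S.Q4 z u u u := by rw [h₃, h₂, h₁]
  have e2 : S.Q4 u u z u = S.Q4 z u u u := by rw [h₂, h₁]
  have e3 : S.Q4 u z u u = S.Q4 z u u u := by rw [h₁]
  have e4 : S.Q4 u z u z = S.Q4 u u z z := by rw [h₂]
  have e5 : S.Q4 u z z u = S.Q4 u u z z := by rw [h₃, h₂]
  have e6 : S.Q4 z u u z = S.Q4 u u z z := by rw [h₁, h₂]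
  have e7 : S.Q4 z u z u = S.Q4 u u z z := by rw [h₃, h₁, h₂]
  have e8 : S.Q4 z z u u = S.Q4 u u z z := by rw [h₂, h₁, h₃, h₂]
  have e9 : S.Q4 z u z z = S.Q4 u z z z := by rw [h₁]
  have e10 : S.Q4 z z u z = S.Q4 u z z z := by rw [h₂, h₁]
  have e11 : S.Q4 z z z u = S.Q4 u z z z := by rw [h₃, h₂, h₁]
  rw [e1, e2, e3, e4, e5, e6, e7, e8, e9, e10, e11]
  ring

theorem Q4_sq_le_of_norm_eq_one {x a : H} (hx : ‖x‖ = 1) (ha : ‖a‖ = 1) :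
    S.Q4 x x a a ≤ 2 * S.C₁ ^ 4 := by
  have hp := S.Q4_add_smul_self x a 1
  have hm := S.Q4_add_smul_self x a (-1)
  have bp := S.embed_L4 (x + (1 : ℝ) • a)
  have bm := S.embed_L4 (x + (-1 : ℝ) • a)
  have np : ‖x + (1 : ℝ) • a‖ ≤ 2 := by
    refine (norm_add_le _ _).trans ?_
    rw [norm_smul, hx, ha]; norm_num
  have nm : ‖x + (-1 : ℝ) • a‖ ≤ 2 := by
    refine (norm_add_le _ _).trans ?_
    rw [norm_smul, hx, ha]; norm_num
  have par := parallelogram_law_with_norm ℝ x a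
  rw [hx, ha] at par
  have ep : x + (1 : ℝ) • a = x + a := by simp
  have em : x + (-1 : ℝ) • a = x - a := by rw [neg_one_smul, sub_eq_add_neg]
  have hsum : ‖x + (1 : ℝ) • a‖ ^ 4 + ‖x + (-1 : ℝ) • a‖ ^ 4 ≤ 16 := by
    rw [ep, em]
    nlinarith [mul_nonneg (sq_nonneg ‖x + a‖) (sq_nonneg ‖x - a‖)]
  have h1 := S.Q4_sq_nonneg x x
  have h2 := S.Q4_sq_nonneg a a
  have hC : 0 ≤ S.C₁ ^ 4 := by have := S.C₁_pos; positivity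
  have := mul_le_mul_of_nonneg_left hsum hC
  linarith

theorem Q4_sq_le (x a : H) : S.Q4 x x a a ≤ 2 * S.C₁ ^ 4 * ‖x‖ ^ 2 * ‖a‖ ^ 2 := by
  rcases eq_or_ne x 0 with rfl | hx
  · simp
  rcases eq_or_ne a 0 with rfl | ha
  · simp
  have hx' := norm_pos_iff.mpr hx
  have ha' := norm_pos_iff.mpr ha
  have h := S.Q4_sq_le_of_norm_eq_one (norm_smul_inv_norm (𝕜 := ℝ) hx)
    (norm_smul_inv_norm (𝕜 := ℝ) ha)
  simp only [map_smul, LinearMap.smul_apply, smul_eq_mul, RCLike.ofReal_real_eq_id, id] at h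
  calc S.Q4 x x a a
      = (‖a‖⁻¹ * (‖a‖⁻¹ * (‖x‖⁻¹ * (‖x‖⁻¹ * S.Q4 x x a a)))) * (‖x‖ ^ 2 * ‖a‖ ^ 2) := by
        field_simp
    _ ≤ (2 * S.C₁ ^ 4) * (‖x‖ ^ 2 * ‖a‖ ^ 2) := by
        gcongr
    _ = _ := by ring

theorem abs_Q4_le (x z w : H) :
    |S.Q4 x x z w| ≤ 2 * S.C₁ ^ 4 * ‖x‖ ^ 2 * ‖z‖ * ‖w‖ := by
  have hC := S.C₁_pos
  exact abs_form_le_of_diag_le (S.Q4 x x) (S.Q4_symm₃ x x) (S.Q4_sq_nonneg x) (by positivity)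
    (S.Q4_sq_le x) z w

theorem Q4_cube_sub_cube (z u v : H) :
    S.Q4 z u u u - S.Q4 z v v v =
      (1 / 2) * (S.Q4 (u + v) (u + v) z (u - v) + S.Q4 u u z (u - v) + S.Q4 v v z (u - v)) := by
  have h₁ := S.Q4_symm₁
  have h₂ := S.Q4_symm₂
  have h₃ := S.Q4_symm₃
  simp only [map_add, map_sub, LinearMap.add_apply]
  have e1 : S.Q4 u u z u = S.Q4 z u u u := by rw [h₂, h₁]
  have e2 : S.Q4 u u z v = S.Q4 z u u v := by rw [h₂, h₁]
  have e3 : S.Q4 u v z u = S.Q4 z u u v := by rw [h₂, h₁, h₃]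
  have e4 : S.Q4 u v z v = S.Q4 z u v v := by rw [h₂, h₁]
  have e5 : S.Q4 v u z u = S.Q4 z u u v := by rw [h₂, h₁, h₂, h₃]
  have e6 : S.Q4 v u z v = S.Q4 z u v v := by rw [h₂, h₁, h₂]
  have e7 : S.Q4 v v z u = S.Q4 z u v v := by rw [h₂, h₁, h₃, h₂]
  have e8 : S.Q4 v v z v = S.Q4 z v v v := by rw [h₂, h₁]
  rw [e1, e2, e3, e4, e5, e6, e7, e8]
  ring

theorem norm_G_le (w : H) : ‖S.G w‖ ≤ S.C₃ ^ 2 * ‖w‖ := by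
  refine norm_le_of_abs_inner_le (by positivity) fun z => ?_
  rw [S.G_def]
  linarith [S.abs_P_le z w]

theorem norm_GV_le (w : H) : ‖S.GV w‖ ≤ S.Vmax * S.C₃ ^ 2 * ‖w‖ := by
  have hV := S.Vmax_nonneg
  refine norm_le_of_abs_inner_le (by positivity) fun z => ?_
  rw [S.GV_def]
  linarith [S.abs_Vf_le z w]

theorem norm_Gc_sub_le (u v : H) :
    ‖S.Gc u - S.Gc v‖ ≤ S.C₁ ^ 4 * (‖u + v‖ ^ 2 + ‖u‖ ^ 2 + ‖v‖ ^ 2) * ‖u - v‖ := by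
  have hC := S.C₁_pos
  refine norm_le_of_abs_inner_le (by positivity) fun z => ?_
  rw [inner_sub_right, S.Gc_def, S.Gc_def, Q4_cube_sub_cube]
  have h₁ := abs_le.mp (S.abs_Q4_le (u + v) z (u - v))
  have h₂ := abs_le.mp (S.abs_Q4_le u z (u - v))
  have h₃ := abs_le.mp (S.abs_Q4_le v z (u - v))
  rw [abs_le]
  constructor <;> linarith [h₁.1, h₁.2, h₂.1, h₂.2, h₃.1, h₃.2]

theorem inner_gradH1 (z u : H) :
    ⟪z, S.gradH1 u⟫ = ⟪z, u⟫ + S.Vf z u + S.β * S.Q4 z u u u := by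
  simp only [gradH1, inner_add_right, inner_smul_right, S.GV_def, S.Gc_def]

theorem norm_gradH1_sub_le (u v : H) :
    ‖S.gradH1 u - S.gradH1 v‖ ≤ (1 + S.Vmax * S.C₃ ^ 2
      + S.β * (S.C₁ ^ 4 * (‖u + v‖ ^ 2 + ‖u‖ ^ 2 + ‖v‖ ^ 2))) * ‖u - v‖ := by
  have hsplit : S.gradH1 u - S.gradH1 v =
      (u - v) + S.GV (u - v) + S.β • (S.Gc u - S.Gc v) := by
    simp only [gradH1, map_sub]; module
  rw [hsplit]
  refine norm_add₃_le.trans ?_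
  rw [norm_smul, Real.norm_of_nonneg S.β_nonneg]
  have h₁ := S.norm_GV_le (u - v)
  have h₂ := mul_le_mul_of_nonneg_left (S.norm_Gc_sub_le u v) S.β_nonneg
  linarith

/-- The Riemannian gradient is the orthogonal projection of the gradient onto `(G u)ᗮ`, so it is
no longer than the gradient shifted by any multiple of `G u`. -/
theorem norm_gradRH1_le (u : H) (c : ℝ) : ‖S.gradRH1 u‖ ≤ ‖S.gradH1 u - c • S.G u‖ := by
  have horth : ⟪S.G u, S.gradRH1 u⟫ = 0 := by
    rw [gradRH1, inner_sub_right, inner_smul_right, real_inner_self_eq_norm_sq, real_inner_comm,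
      S.G_def]
    rcases eq_or_ne (S.G u) 0 with h | h
    · have : S.P (S.gradH1 u) u = 0 := by rw [← S.G_def, h, inner_zero_right]
      simp [this]
    · have := norm_ne_zero_iff.mpr h
      field_simp
      ring
  obtain ⟨d, hd⟩ : ∃ d : ℝ, S.gradH1 u - c • S.G u = S.gradRH1 u + d • S.G u :=
    ⟨S.P (S.gradH1 u) u / ‖S.G u‖ ^ 2 - c, by rw [gradRH1]; module⟩
  have hinner : ⟪S.gradRH1 u, d • S.G u⟫ = 0 := by
    rw [inner_smul_right, real_inner_comm, horth, mul_zero]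
  have hpyth := norm_add_sq_eq_norm_sq_add_norm_sq_real hinner
  rw [hd]
  nlinarith [norm_nonneg (S.gradRH1 u + d • S.G u), norm_nonneg (S.gradRH1 u),
    mul_self_nonneg ‖d • S.G u‖]

/-- Homogenized form of the minimality of the ground state. -/
theorem energy_mul_sq_le {ustar : H} (hgs : S.IsGroundState ustar) {w : H} (hw : 0 < S.P w w) :
    S.energy ustar * S.P w w ^ 2 ≤
      (1 / 2) * (‖w‖ ^ 2 + S.Vf w w) * S.P w w + S.β / 4 * S.Q4 w w w w := by
  obtain ⟨r, hr, hrw⟩ : ∃ r : ℝ, 0 < r ∧ r ^ 2 = S.P w w :=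
    ⟨√(S.P w w), Real.sqrt_pos.mpr hw, Real.sq_sqrt hw.le⟩
  have hM : r⁻¹ • w ∈ S.Msphere := by
    change S.P (r⁻¹ • w) (r⁻¹ • w) = 1
    simp only [map_smul, LinearMap.smul_apply, smul_eq_mul, ← hrw]
    field_simp
  have h := hgs.2 _ hM
  have hE : S.energy (r⁻¹ • w) * r ^ 4 =
      (1 / 2) * (‖w‖ ^ 2 + S.Vf w w) * r ^ 2 + S.β / 4 * S.Q4 w w w w := by
    simp only [energy, norm_smul, norm_inv, Real.norm_of_nonneg hr.le, map_smul,
      LinearMap.smul_apply, smul_eq_mul]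
    field_simp
  rw [← hrw, ← hE]
  have := mul_le_mul_of_nonneg_right h (pow_nonneg hr.le 4)
  linarith

theorem inner_gradH1_eq_zero {ustar : H} (hgs : S.IsGroundState ustar) {z : H}
    (hz : S.P z ustar = 0) : ⟪z, S.gradH1 ustar⟫ = 0 := by
  have hu : S.P ustar ustar = 1 := hgs.1
  have hP (t : ℝ) : S.P (ustar + t • z) (ustar + t • z) = 1 + t ^ 2 * S.P z z := by
    simp only [map_add, map_smul, LinearMap.add_apply, LinearMap.smul_apply, smul_eq_mul, hu, hz,
      S.P_symm ustar z]
    ring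
  have hN (t : ℝ) : ‖ustar + t • z‖ ^ 2 = ‖ustar‖ ^ 2 + 2 * t * ⟪z, ustar⟫ + t ^ 2 * ‖z‖ ^ 2 := by
    rw [norm_add_sq_real, inner_smul_right, norm_smul, real_inner_comm, mul_pow, Real.norm_eq_abs,
      sq_abs]
    ring
  have hV (t : ℝ) : S.Vf (ustar + t • z) (ustar + t • z) =
      S.Vf ustar ustar + 2 * t * S.Vf z ustar + t ^ 2 * S.Vf z z := by
    simp only [map_add, map_smul, LinearMap.add_apply, LinearMap.smul_apply, smul_eq_mul,
      S.Vf_symm ustar z]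
    ring
  set a := ⟪z, S.gradH1 ustar⟫ with ha
  rw [inner_gradH1] at ha
  obtain ⟨b, c, d, hpoly⟩ : ∃ b c d : ℝ, ∀ t : ℝ,
      0 ≤ a * t + t ^ 2 * (b + c * t + d * t ^ 2) := by
    refine ⟨(1 / 2) * ((‖ustar‖ ^ 2 + S.Vf ustar ustar) * S.P z z + ‖z‖ ^ 2 + S.Vf z z)
        + S.β / 4 * (6 * S.Q4 ustar ustar z z) - 2 * S.energy ustar * S.P z z,
      (⟪z, ustar⟫ + S.Vf z ustar) * S.P z z + S.β * S.Q4 ustar z z z,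
      (1 / 2) * (‖z‖ ^ 2 + S.Vf z z) * S.P z z + S.β / 4 * S.Q4 z z z z
        - S.energy ustar * S.P z z ^ 2, fun t => ?_⟩
    have hpos : 0 < S.P (ustar + t • z) (ustar + t • z) := by
      rw [hP]
      have := S.P_nonneg z
      positivity
    have h := S.energy_mul_sq_le hgs hpos
    rw [hP, hN, hV, Q4_add_smul_self] at h
    have hE : S.energy ustar = (1 / 2) * ‖ustar‖ ^ 2 + (1 / 2) * S.Vf ustar ustar
      + S.β / 4 * S.Q4 ustar ustar ustar ustar := rfl
    rw [ha]
    rw [← sub_nonneg] at h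
    refine h.trans_eq ?_
    linear_combination -hE
  have hmin : IsLocalMin (fun t : ℝ => a * t + t ^ 2 * (b + c * t + d * t ^ 2)) 0 :=
    Eventually.of_forall fun t => by simpa using hpoly t
  have h₁ := (hasDerivAt_id (0 : ℝ)).const_mul a
  have h₂ := ((hasDerivAt_id (0 : ℝ)).pow 2).mul
    ((((hasDerivAt_id (0 : ℝ)).const_mul c).const_add b).add
      (((hasDerivAt_id (0 : ℝ)).pow 2).const_mul d))
  exact hmin.hasDerivAt_eq_zero (((h₁.add h₂).congr_deriv (by simp)).congr_of_eventuallyEq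
    (.of_forall fun t => by simp))

/-- The Euler–Lagrange equation `∇E(u*) = λ G u*`. -/
theorem gradH1_eq_smul_G {ustar : H} (hgs : S.IsGroundState ustar) :
    S.gradH1 ustar = ⟪ustar, S.gradH1 ustar⟫ • S.G ustar := by
  refine ext_inner_left ℝ fun z => ?_
  have hu : S.P ustar ustar = 1 := hgs.1
  have h := S.inner_gradH1_eq_zero hgs (z := z - S.P z ustar • ustar) (by simp [hu])
  rw [inner_sub_left, real_inner_smul_left] at h
  rw [inner_smul_right, S.G_def]
  linarith

end GPSetting

/-- **Local Lipschitz bound for the Riemannian `H¹`-gradient**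
(Lemma `lem:Lg`).  Let `Cu` be the constant from the energy-decay theorem for
the `H¹`-scheme.  There exists a constant `Lg > 0` (depending only on
`Ω, d, β, V, u*` and on `Cu`, hence on `‖u₀‖_{H¹₀}`) such that
`‖∇^R_{H¹}E(u)‖_{H¹₀} ≤ Lg ‖u − u*‖_{H¹₀}` for every `u ∈ M` with
`‖u‖_{H¹₀} ≤ Cu` and `‖u − u*‖_{H¹₀}` sufficiently small. -/
theorem grad_local_lipschitz_H1
    {H : Type*} [NormedAddCommGroup H] [InnerProductSpace ℝ H]
    (S : GPSetting H) (ustar : H) (hgs : S.IsGroundState ustar)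
    (Cu : ℝ) (hCu : 0 < Cu) :
    ∃ Lg : ℝ, 0 < Lg ∧ ∃ δ : ℝ, 0 < δ ∧
      ∀ u ∈ S.Msphere, ‖u‖ ≤ Cu → ‖u - ustar‖ ≤ δ →
        ‖S.gradRH1 u‖ ≤ Lg * ‖u - ustar‖ := by
  have hV := S.Vmax_nonneg
  have hβ := S.β_nonneg
  have hC₁ := S.C₁_pos
  set lam := ⟪ustar, S.gradH1 ustar⟫
  refine ⟨1 + S.Vmax * S.C₃ ^ 2
      + S.β * (S.C₁ ^ 4 * ((Cu + ‖ustar‖) ^ 2 + Cu ^ 2 + ‖ustar‖ ^ 2)) + |lam| * S.C₃ ^ 2,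
    by positivity, 1, one_pos, fun u _ hu _ => ?_⟩
  have hsplit : S.gradH1 u - lam • S.G u =
      (S.gradH1 u - S.gradH1 ustar) - lam • S.G (u - ustar) := by
    rw [map_sub, smul_sub, ← S.gradH1_eq_smul_G hgs]
    abel
  have hadd : ‖u + ustar‖ ≤ Cu + ‖ustar‖ := (norm_add_le _ _).trans (by gcongr)
  calc ‖S.gradRH1 u‖ ≤ ‖(S.gradH1 u - S.gradH1 ustar) - lam • S.G (u - ustar)‖ :=
        hsplit ▸ S.norm_gradRH1_le u lam
    _ ≤ ‖S.gradH1 u - S.gradH1 ustar‖ + |lam| * ‖S.G (u - ustar)‖ := by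
        refine (norm_sub_le _ _).trans_eq ?_
        rw [norm_smul, Real.norm_eq_abs]
    _ ≤ (1 + S.Vmax * S.C₃ ^ 2
          + S.β * (S.C₁ ^ 4 * (‖u + ustar‖ ^ 2 + ‖u‖ ^ 2 + ‖ustar‖ ^ 2))) * ‖u - ustar‖
        + |lam| * (S.C₃ ^ 2 * ‖u - ustar‖) := by
        gcongr
        · exact S.norm_gradH1_sub_le u ustar
        · exact S.norm_G_le _
    _ ≤ (1 + S.Vmax * S.C₃ ^ 2
          + S.β * (S.C₁ ^ 4 * ((Cu + ‖ustar‖) ^ 2 + Cu ^ 2 + ‖ustar‖ ^ 2))) * ‖u - ustar‖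
        + |lam| * (S.C₃ ^ 2 * ‖u - ustar‖) := by
        gcongr
    _ = _ := by ring
end

section
/- Let u* be the ground state of the Gross–Pitaevskii eigenvalue problem and let C_u > 0. For every u ∈ M with ‖u‖_{H^1_0(Ω)} ≤ C_u, it holds that ‖G_{a_u}u − G_{a_{u*}}u*‖_{a_{u*}(Ω)} ≤ L_G·‖u − u*‖_{a_{u*}(Ω)}, where L_G = C₃² + βC₁⁴C₃(C_u + ‖u*‖_{H^1_0(Ω)}). -/
open scoped RealInnerProductSpace
open Filter Topology

namespace GPSetting

variable {H : Type*} [NormedAddCommGroup H] [InnerProductSpace ℝ H] (S : GPSetting H)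

theorem P_sq_le (z w : H) : S.P z w ^ 2 ≤ S.P z z * S.P w w :=
  LinearMap.BilinForm.apply_sq_le_of_symm S.P S.P_nonneg ⟨fun z w => S.P_symm z w⟩ z w

theorem Q4_sub_left (a b x c d : H) :
    S.Q4 (a - b) x c d = S.Q4 a x c d - S.Q4 b x c d := by
  rw [S.Q4_symm₁ (a - b), S.Q4_symm₁ a, S.Q4_symm₁ b]
  simp only [map_sub, LinearMap.sub_apply]

theorem Q4_sq_sq_le_add (a c : H) :
    S.Q4 a a c c ≤ S.C₁ ^ 4 * ((‖a‖ ^ 2 + ‖c‖ ^ 2) / 2) ^ 2 := by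
  have hC := S.C₁_pos
  obtain ⟨p, hp⟩ : ∃ p, p = (1 / 2 : ℝ) • (a + c) := ⟨_, rfl⟩
  obtain ⟨q, hq⟩ : ∃ q, q = (1 / 2 : ℝ) • (a - c) := ⟨_, rfl⟩
  have ha : a = p + q := by rw [hp, hq]; module
  have hc : c = p - q := by rw [hp, hq]; module
  have hnorm : (‖a‖ ^ 2 + ‖c‖ ^ 2) / 2 = ‖p‖ ^ 2 + ‖q‖ ^ 2 := by
    rw [ha, hc, norm_add_sq_real, norm_sub_sq_real]; ring
  have hQ : S.Q4 a a c c = S.Q4 p p p p - 2 * S.Q4 p p q q + S.Q4 q q q q := by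
    rw [ha, hc]
    simp only [map_add, map_sub, LinearMap.add_apply, LinearMap.sub_apply]
    have h1 : S.Q4 p q q p = S.Q4 p p q q := by rw [S.Q4_symm₃, S.Q4_symm₂]
    have h2 : S.Q4 p q p q = S.Q4 p p q q := by rw [S.Q4_symm₂]
    have h3 : S.Q4 q p q p = S.Q4 p p q q := by rw [S.Q4_symm₁, h1]
    have h4 : S.Q4 q p p q = S.Q4 p p q q := by rw [S.Q4_symm₁, h2]
    have h5 : S.Q4 q q p p = S.Q4 p p q q := by rw [S.Q4_symm₂, h3]
    have h6 : S.Q4 p p q p = S.Q4 p p p q := by rw [S.Q4_symm₃]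
    have h7 : S.Q4 p q p p = S.Q4 p p p q := by rw [S.Q4_symm₂, h6]
    have h8 : S.Q4 q p p p = S.Q4 p p p q := by rw [S.Q4_symm₁, h7]
    have h9 : S.Q4 q q q p = S.Q4 q q p q := by rw [S.Q4_symm₃]
    have h10 : S.Q4 q p q q = S.Q4 q q p q := by rw [S.Q4_symm₂]
    have h11 : S.Q4 p q q q = S.Q4 q q p q := by rw [S.Q4_symm₁, h10]
    rw [h1, h2, h3, h4, h5, h6, h7, h8, h9, h10, h11]
    ring
  rw [hnorm, hQ]
  have hcross : 0 ≤ S.C₁ ^ 4 * (‖p‖ ^ 2 * ‖q‖ ^ 2) := by positivity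
  nlinarith [S.embed_L4 p, S.embed_L4 q, S.Q4_sq_nonneg p q]

theorem Q4_sq_sq_le (a c : H) : S.Q4 a a c c ≤ S.C₁ ^ 4 * ‖a‖ ^ 2 * ‖c‖ ^ 2 := by
  rcases eq_or_ne a 0 with rfl | ha
  · simp
  rcases eq_or_ne c 0 with rfl | hc
  · simp
  have h := S.Q4_sq_sq_le_add (‖c‖ • a) (‖a‖ • c)
  simp only [map_smul, LinearMap.smul_apply, smul_eq_mul, norm_smul, norm_norm] at h
  have hpos : 0 < ‖a‖ ^ 2 * ‖c‖ ^ 2 := by positivity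
  refine le_of_mul_le_mul_left ?_ hpos
  linarith

theorem abs_Q4_sq_le (a b c : H) : |S.Q4 a a b c| ≤ S.C₁ ^ 4 * ‖a‖ ^ 2 * ‖b‖ * ‖c‖ := by
  have hC := S.C₁_pos
  have h := LinearMap.BilinForm.apply_sq_le_of_symm (S.Q4 a a) (S.Q4_sq_nonneg a)
    ⟨fun z w => S.Q4_symm₃ a a z w⟩ b c
  refine abs_le_of_sq_le_sq (h.trans ?_) (by positivity)
  calc S.Q4 a a b b * S.Q4 a a c c
      ≤ (S.C₁ ^ 4 * ‖a‖ ^ 2 * ‖b‖ ^ 2) * (S.C₁ ^ 4 * ‖a‖ ^ 2 * ‖c‖ ^ 2) :=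
        mul_le_mul (S.Q4_sq_sq_le a b) (S.Q4_sq_sq_le a c) (S.Q4_sq_nonneg a c) (by positivity)
    _ = _ := by ring

theorem abs_Q4_le_add (a b c d : H) :
    |S.Q4 a b c d| ≤ S.C₁ ^ 4 * ((‖a‖ ^ 2 + ‖b‖ ^ 2) / 2) * ‖c‖ * ‖d‖ := by
  have hpol : 4 * S.Q4 a b c d =
      S.Q4 (a + b) (a + b) c d - S.Q4 (a - b) (a - b) c d := by
    simp only [map_add, S.Q4_sub_left, map_sub, LinearMap.add_apply, LinearMap.sub_apply]
    rw [S.Q4_symm₁ b a c d]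
    ring
  have h1 := abs_le.mp (S.abs_Q4_sq_le (a + b) c d)
  have h2 := abs_le.mp (S.abs_Q4_sq_le (a - b) c d)
  rw [norm_add_sq_real] at h1
  rw [norm_sub_sq_real] at h2
  rw [abs_le]
  constructor <;> linarith [h1.1, h1.2, h2.1, h2.2]

/-- The sharp bound on the quadrilinear form: on a Hilbert space, a symmetric multilinear form has
the same norm as its restriction to the diagonal. -/
theorem abs_Q4_le_s18 (a b c d : H) :
    |S.Q4 a b c d| ≤ S.C₁ ^ 4 * ‖a‖ * ‖b‖ * ‖c‖ * ‖d‖ := by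
  rcases eq_or_ne a 0 with rfl | ha
  · simp
  rcases eq_or_ne b 0 with rfl | hb
  · simp
  have h := S.abs_Q4_le_add (‖b‖ • a) (‖a‖ • b) c d
  simp only [map_smul, LinearMap.smul_apply, smul_eq_mul, norm_smul, norm_norm, abs_mul,
    abs_norm] at h
  have hpos : 0 < ‖a‖ * ‖b‖ := by positivity
  refine le_of_mul_le_mul_left ?_ hpos
  linarith

theorem norm_sq_le_auinner (u z : H) : ‖z‖ ^ 2 ≤ S.auinner u z z := by
  have h := mul_nonneg S.β_nonneg (S.Q4_sq_nonneg u z)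
  rw [auinner, real_inner_self_eq_norm_sq]
  linarith [S.Vf_nonneg z]

theorem norm_le_aunorm (u z : H) : ‖z‖ ≤ S.aunorm u z :=
  Real.le_sqrt_of_sq_le (S.norm_sq_le_auinner u z)

theorem aunorm_sq (u z : H) : S.aunorm u z ^ 2 = S.auinner u z z :=
  Real.sq_sqrt ((sq_nonneg _).trans (S.norm_sq_le_auinner u z))

theorem norm_Gau_le {u : H} (hu : u ∈ S.Msphere) : ‖S.Gau u u‖ ≤ S.C₃ := by
  have hC := S.C₃_pos
  have h1 : ‖S.Gau u u‖ ^ 2 ≤ S.P (S.Gau u u) u :=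
    (S.norm_sq_le_auinner u _).trans_eq (S.Gau_def u _ u)
  have h2 : S.P (S.Gau u u) u ≤ S.C₃ * ‖S.Gau u u‖ := by
    refine le_of_abs_le (abs_le_of_sq_le_sq ?_ (by positivity))
    have h := S.P_sq_le (S.Gau u u) u
    rw [show S.P u u = 1 from hu, mul_one] at h
    rw [mul_pow]
    exact h.trans (S.poincare _)
  by_contra! hlt
  nlinarith

theorem auinner_Gau_sub_Gau (u v z : H) :
    S.auinner v z (S.Gau u u - S.Gau v v) =
      S.P z (u - v) - S.β * S.Q4 (u - v) (u + v) z (S.Gau u u) := by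
  have h1 := S.Gau_def u z u
  have h2 := S.Gau_def v z v
  simp only [auinner, S.Q4_sub_left, map_sub, map_add, LinearMap.add_apply, inner_sub_right]
  rw [S.Q4_symm₁ v u]
  linarith

end GPSetting

/-- **Lipschitz estimate for the `a_u`-Green operator** (Lemma `lem:Gau`).
Let `u*` be the ground state and `Cu > 0`.  For every `u ∈ M` with
`‖u‖_{H¹₀} ≤ Cu`,
`‖G_{a_u}u − G_{a_{u*}}u*‖_{a_{u*}} ≤ L_G ‖u − u*‖_{a_{u*}}` with
`L_G = C₃² + β C₁⁴ C₃ (Cu + ‖u*‖_{H¹₀})`. -/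
theorem Gau_lipschitz
    {H : Type*} [NormedAddCommGroup H] [InnerProductSpace ℝ H]
    (S : GPSetting H) (ustar : H) (hgs : S.IsGroundState ustar)
    (Cu : ℝ) (hCu : 0 < Cu) :
    ∀ u ∈ S.Msphere, ‖u‖ ≤ Cu →
      S.aunorm ustar (S.Gau u u - S.Gau ustar ustar) ≤
        (S.C₃ ^ 2 + S.β * S.C₁ ^ 4 * S.C₃ * (Cu + ‖ustar‖)) *
          S.aunorm ustar (u - ustar) := by
  intro u hu hle
  set e := S.Gau u u - S.Gau ustar ustar with he
  set L := S.C₃ ^ 2 + S.β * S.C₁ ^ 4 * S.C₃ * (Cu + ‖ustar‖) with hL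
  have hβ := S.β_nonneg
  have hC₁ := S.C₁_pos
  have hC₃ := S.C₃_pos
  have hL_nonneg : 0 ≤ L := by positivity
  have hP := (abs_le.mp (S.abs_P_le e (u - ustar))).2
  have hQ : -S.Q4 (u - ustar) (u + ustar) e (S.Gau u u) ≤
      S.C₁ ^ 4 * ‖u - ustar‖ * (Cu + ‖ustar‖) * ‖e‖ * S.C₃ := by
    refine (neg_le_abs _).trans ((S.abs_Q4_le_s18 _ _ _ _).trans ?_)
    have hsum : ‖u + ustar‖ ≤ Cu + ‖ustar‖ := (norm_add_le _ _).trans (by gcongr)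
    have hG := S.norm_Gau_le hu
    gcongr
  have hsq : S.aunorm ustar e ^ 2 ≤ L * ‖u - ustar‖ * ‖e‖ := by
    rw [S.aunorm_sq, he, S.auinner_Gau_sub_Gau, ← he, hL]
    linarith [mul_le_mul_of_nonneg_left hQ hβ]
  have hd := S.norm_le_aunorm ustar (u - ustar)
  have he' := S.norm_le_aunorm ustar e
  have hD : 0 ≤ L * S.aunorm ustar (u - ustar) := mul_nonneg hL_nonneg (Real.sqrt_nonneg _)
  have hbound : S.aunorm ustar e ^ 2 ≤ L * S.aunorm ustar (u - ustar) * S.aunorm ustar e :=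
    hsq.trans (by gcongr)
  by_contra! hlt
  nlinarith
end
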